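/- Let R be a Noetherian regular local ring of prime characteristic p > 0 satisfying condition (*), let g ∈ R, and let r ≥ 1 and e ≥ 1 be integers. Then the generalized test ideal of the principal ideal (g) with coefficient r/p^e equals I_e((g^r)), i.e. τ((g)^{r/p^e}) = I_e((g^r)). -/

import Mathlib

/-- The `q`-th bracket power of an ideal: the ideal generated by the `q`-th powers
of the elements of `J`. -/
def bracketPow {R : Type*} [CommRing R] (J : Ideal R) (q : ℕ) : Ideal R :=
  Ideal.span ((fun x => x ^ q) '' (J : Set R))

/-- `Ie p a e` is the intersection of all ideals `I` with `a ⊆ I^{[p^e]}`. -/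
def Ie {R : Type*} [CommRing R] (p : ℕ) (a : Ideal R) (e : ℕ) : Ideal R :=
  sInf {I : Ideal R | a ≤ bracketPow I (p ^ e)}

/-- Condition (*): `a ⊆ I_e(a)^{[p^e]}` for every ideal `a` and every `e ≥ 1`. -/
def CondStar (R : Type*) [CommRing R] (p : ℕ) : Prop :=
  ∀ (a : Ideal R) (e : ℕ), 1 ≤ e → a ≤ bracketPow (Ie p a e) (p ^ e)

/-- The generalized test ideal `τ(a^c)`: the supremum, in the lattice of ideals of `R`,
of the ideals `I_e(a^{⌈c p^e⌉})` for `e ≥ 1`. -/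
noncomputable def tau {R : Type*} [CommRing R] (p : ℕ) (a : Ideal R) (c : ℝ) : Ideal R :=
  ⨆ e : {e : ℕ // 1 ≤ e}, Ie p (a ^ ⌈c * (p : ℝ) ^ (e : ℕ)⌉₊) (e : ℕ)

/-- `c > 0` is an F-jumping coefficient of `a` if `τ(a^c) ≠ τ(a^{c-ε})` for all
`0 < ε < c`. -/
def IsFJumpingCoeff {R : Type*} [CommRing R] (p : ℕ) (a : Ideal R) (c : ℝ) : Prop :=
  0 < c ∧ ∀ ε : ℝ, 0 < ε → ε < c → tau p a c ≠ tau p a (c - ε)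

/-- `x` is an accumulation point of `S ⊆ ℝ`. -/
def IsAccumulationPt (S : Set ℝ) (x : ℝ) : Prop :=
  ∀ ε : ℝ, 0 < ε → ∃ y ∈ S, y ≠ x ∧ |y - x| < ε

/-- `R` is a regular local ring: Noetherian, local, and the maximal ideal is generated
by `dim R` elements. -/
def IsRegularStmt (R : Type*) [CommRing R] [IsLocalRing R] : Prop :=
  ∃ s : Finset R, IsLocalRing.maximalIdeal R = Ideal.span (s : Set R) ∧
    (s.card : WithBot (WithTop ℕ)) = ringKrullDim R

theorem isDomain_of_bot_isPrime {R : Type*} [CommRing R] (h : (⊥ : Ideal R).IsPrime) :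
    IsDomain R := by
  have h1 : Nontrivial R := ⟨0, 1, fun h01 => h.ne_top ((Ideal.eq_top_iff_one _).mpr (by simp [← h01]))⟩
  have h2 : NoZeroDivisors R := ⟨fun {a b} hab => by
    simpa using h.mem_or_mem (x := a) (y := b) (by simpa using hab)⟩
  exact NoZeroDivisors.to_isDomain R

theorem regular_isDomain_aux.{u} (n : ℕ) : ∀ (R : Type u) [CommRing R] [IsNoetherianRing R]
    [IsLocalRing R] (s : Finset R), IsLocalRing.maximalIdeal R = Ideal.span (s : Set R) →
    s.card ≤ n → (n : WithBot ℕ∞) ≤ ringKrullDim R → IsDomain R := by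
  classical
  induction n with
  | zero =>
    intro R _ _ _ s hs hc _
    have h0 : s = ∅ := by simpa using hc
    have hm : IsLocalRing.maximalIdeal R = ⊥ := by simpa [h0] using hs
    have : (⊥ : Ideal R).IsPrime := hm ▸ inferInstance
    exact isDomain_of_bot_isPrime this
  | succ n ih =>
    intro R _ _ _ s hs hc hd
    have hht := IsLocalRing.maximalIdeal_height_eq_ringKrullDim (R := R)
    have hmin : ∀ P ∈ minimalPrimes R, ¬ IsLocalRing.maximalIdeal R ≤ P := by
      intro P hP hle
      have hPp : P.IsPrime := hP.1.1
      have hPm : P = IsLocalRing.maximalIdeal R :=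
        le_antisymm (IsLocalRing.le_maximalIdeal hPp.ne_top) hle
      have h0 : P.height = 0 := Ideal.height_eq_zero_iff.mpr hP
      rw [← hht, ← hPm, h0] at hd
      have : ((n + 1 : ℕ) : ℕ∞) ≤ 0 := by exact_mod_cast hd
      simp at this
    have hsq : ¬ IsLocalRing.maximalIdeal R ≤ IsLocalRing.maximalIdeal R ^ 2 := by
      intro h
      have hb : IsLocalRing.maximalIdeal R = ⊥ := by
        apply Submodule.eq_bot_of_le_smul_of_le_jacobson_bot (IsLocalRing.maximalIdeal R) _
          (IsNoetherian.noetherian _)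
        · rw [smul_eq_mul, ← sq]; exact h
        · exact IsLocalRing.maximalIdeal_le_jacobson _
      obtain ⟨P, hP⟩ : (minimalPrimes R).Nonempty := by
        exact Set.nonempty_coe_sort.mp (Ideal.nonempty_minimalPrimes (I := (⊥ : Ideal R)) bot_ne_top)
      exact hmin P hP (hb ▸ bot_le)
    obtain ⟨y, hym, hyn⟩ : ∃ y ∈ IsLocalRing.maximalIdeal R,
        y ∉ ⋃ i ∈ insert (IsLocalRing.maximalIdeal R ^ 2) (minimalPrimes R), ((id i : Ideal R) : Set R) := by
      by_contra! hcon
      have := (Ideal.subset_union_prime_finite (f := (id : Ideal R → Ideal R))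
        ((minimalPrimes.finite_of_isNoetherianRing R).insert (IsLocalRing.maximalIdeal R ^ 2))
        (IsLocalRing.maximalIdeal R ^ 2) (IsLocalRing.maximalIdeal R ^ 2) (by
          intro i hi h1 _
          rcases hi with rfl | hi
          · exact absurd rfl h1
          · exact hi.1.1)).mp hcon
      obtain ⟨i, hi, hle⟩ := this
      rcases hi with rfl | hi
      · exact hsq hle
      · exact hmin i hi hle
    simp only [Set.mem_iUnion, not_exists, id, SetLike.mem_coe] at hyn
    have hy2 : y ∉ IsLocalRing.maximalIdeal R ^ 2 := hyn _ (Set.mem_insert _ _)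
    have hyP : ∀ P ∈ minimalPrimes R, y ∉ P := fun P hP => hyn P (Set.mem_insert_of_mem _ hP)
    have hyu : Ideal.span {y} ≠ ⊤ := fun h => by
      have : Ideal.span {y} ≤ IsLocalRing.maximalIdeal R := by
        rw [Ideal.span_singleton_le_iff_mem]; exact hym
      rw [h] at this
      exact (IsLocalRing.maximalIdeal.isMaximal R).ne_top (top_le_iff.mp this)
    have : Nontrivial (R ⧸ Ideal.span {y}) := Ideal.Quotient.nontrivial_iff.mpr hyu
    have hloc : IsLocalRing (R ⧸ Ideal.span {y}) :=
      IsLocalRing.of_surjective' (Ideal.Quotient.mk _) Ideal.Quotient.mk_surjective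
    -- exchange
    obtain ⟨c, hcs, hcy⟩ := Submodule.mem_span_finset.mp (show y ∈ Submodule.span R (s : Set R) by
      have h := hym
      rw [hs] at h
      exact h)
    obtain ⟨i, his, hiu⟩ : ∃ i ∈ s, IsUnit (c i) := by
      by_contra! hcon
      apply hy2
      rw [← hcy, sq]
      refine Ideal.sum_mem _ fun i hi => Ideal.mul_mem_mul ?_ ?_
      · exact (IsLocalRing.mem_maximalIdeal _).mpr (hcon i hi)
      · rw [hs]; exact Ideal.subset_span hi
    let f := Ideal.Quotient.mk (Ideal.span {y})
    have hfy : f y = 0 := Ideal.Quotient.eq_zero_iff_mem.mpr (Ideal.mem_span_singleton_self y)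
    have hmap : IsLocalRing.maximalIdeal (R ⧸ Ideal.span {y})
        = Ideal.span (((s.erase i).image f : Finset _) : Set _) := by
      have h1 : IsLocalRing.maximalIdeal (R ⧸ Ideal.span {y})
          = Ideal.map f (IsLocalRing.maximalIdeal R) := by
        have : (Ideal.map f (IsLocalRing.maximalIdeal R)).IsMaximal := by
          apply (Ideal.map_eq_top_or_isMaximal_of_surjective f Ideal.Quotient.mk_surjective
            (IsLocalRing.maximalIdeal.isMaximal R)).resolve_left
          intro ht
          have hk : RingHom.ker f ≤ IsLocalRing.maximalIdeal R := by
            rw [Ideal.mk_ker, Ideal.span_singleton_le_iff_mem]; exact hym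
          have h2 := Ideal.comap_map_of_surjective' f Ideal.Quotient.mk_surjective
            (IsLocalRing.maximalIdeal R)
          rw [ht, Ideal.comap_top, sup_eq_left.mpr hk] at h2
          exact (IsLocalRing.maximalIdeal.isMaximal R).ne_top h2.symm
        exact (IsLocalRing.eq_maximalIdeal this).symm
      rw [h1, hs, Ideal.map_span]
      apply le_antisymm
      · rw [Ideal.span_le]
        rintro _ ⟨j, hj, rfl⟩
        by_cases hji : j = i
        · subst hji
          have h3 := congrArg f hcy
          rw [hfy, ← Finset.add_sum_erase _ _ his, map_add, smul_eq_mul, map_mul, map_sum] at h3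
          have h4 : f (c j) * f j ∈ Ideal.span (((s.erase j).image f : Finset _) : Set (R ⧸ Ideal.span {y})) := by
            rw [eq_neg_of_add_eq_zero_left h3]
            refine neg_mem (Ideal.sum_mem _ fun k hk => ?_)
            rw [smul_eq_mul, map_mul]
            exact Ideal.mul_mem_left _ _ (Ideal.subset_span (by
              exact Finset.mem_coe.mpr (Finset.mem_image_of_mem f hk)))
          exact (Ideal.unit_mul_mem_iff_mem _ (hiu.map f)).mp h4
        · exact Ideal.subset_span (Finset.mem_coe.mpr
            (Finset.mem_image_of_mem f (Finset.mem_erase.mpr ⟨hji, hj⟩)))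
      · apply Ideal.span_mono
        rw [Finset.coe_image]
        exact Set.image_mono (Finset.coe_subset.mpr (Finset.erase_subset _ _))
    have hcard : ((s.erase i).image f).card ≤ n := by
      refine Finset.card_image_le.trans ?_
      rw [Finset.card_erase_of_mem his]; omega
    have hdim : (n : WithBot ℕ∞) ≤ ringKrullDim (R ⧸ Ideal.span {y}) := by
      have h5 := Ideal.height_le_ringKrullDim_quotient_add_one hym
      rw [hht] at h5
      have h6 := hd.trans h5
      push_cast at h6
      exact (WithBot.add_le_add_iff_right' (c := (1 : WithBot (WithTop ℕ))) WithBot.one_ne_bot (by decide)).mp h6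
    have hdom := ih (R ⧸ Ideal.span {y}) _ hmap hcard hdim
    have hprime : (Ideal.span {y}).IsPrime := (Ideal.Quotient.isDomain_iff_prime _).mp hdom
    obtain ⟨P, hP, hPy⟩ := Ideal.exists_minimalPrimes_le (I := ⊥) (J := Ideal.span {y}) bot_le
    have hPp : P.IsPrime := hP.1.1
    have hPb : P = ⊥ := by
      apply Submodule.eq_bot_of_le_smul_of_le_jacobson_bot (IsLocalRing.maximalIdeal R) _
        (IsNoetherian.noetherian _)
      · intro z hz
        obtain ⟨w, rfl⟩ := Ideal.mem_span_singleton'.mp (hPy hz)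
        rw [smul_eq_mul, mul_comm w y]
        exact Ideal.mul_mem_mul hym ((hPp.mem_or_mem hz).resolve_right (hyP P hP))
      · exact IsLocalRing.maximalIdeal_le_jacobson _
    exact isDomain_of_bot_isPrime (hPb ▸ hPp)

theorem bracketPow_mono' {R : Type*} [CommRing R] {I J : Ideal R} (h : I ≤ J) (q : ℕ) :
    bracketPow I q ≤ bracketPow J q :=
  Ideal.span_mono (Set.image_mono h)

theorem mem_of_pow_mem_bracket {R : Type*} [CommRing R] [IsDomain R] (p : ℕ) (hp : p.Prime)
    (hstar : CondStar R p) (e : ℕ) (he : 1 ≤ e) (J : Ideal R) (x : R)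
    (hx : x ^ p ^ e ∈ bracketPow J (p ^ e)) : x ∈ J := by
  by_cases hx0 : x = 0
  · rw [hx0]; exact J.zero_mem
  have hle : Ie p (Ideal.span {x ^ p ^ e}) e ≤ Ideal.span {x} ⊓ J := by
    apply le_inf
    · apply sInf_le
      rw [Set.mem_setOf_eq, Ideal.span_singleton_le_iff_mem]
      exact Ideal.subset_span ⟨x, Ideal.mem_span_singleton_self x, rfl⟩
    · apply sInf_le
      rw [Set.mem_setOf_eq, Ideal.span_singleton_le_iff_mem]
      exact hx
  have h1 := bracketPow_mono' hle (p ^ e) (hstar _ e he (Ideal.mem_span_singleton_self _))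
  let K : Ideal R := Submodule.comap (LinearMap.mulLeft R x) J
  have h2 : bracketPow (Ideal.span {x} ⊓ J) (p ^ e) ≤ Ideal.span {x ^ p ^ e} * K := by
    apply Ideal.span_le.mpr
    rintro _ ⟨w, ⟨hw1, hw2⟩, rfl⟩
    obtain ⟨k, rfl⟩ := Ideal.mem_span_singleton.mp hw1
    have hk : k ∈ K := hw2
    simp only [mul_pow, SetLike.mem_coe]
    exact Ideal.mul_mem_mul (Ideal.mem_span_singleton_self _)
      (Ideal.pow_mem_of_mem K hk _ (pow_pos hp.pos e))
  obtain ⟨z, hz, hxz⟩ := Ideal.mem_span_singleton_mul.mp (h2 h1)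
  have hz1 : z = 1 := mul_left_cancel₀ (pow_ne_zero (p ^ e) hx0) (by rw [hxz, mul_one])
  have : x * 1 ∈ J := hz1 ▸ hz
  simpa using this

theorem pow_mem_bracket_bracket {R : Type*} [CommRing R] (p : ℕ) (hp : p.Prime) [CharP R p]
    (I : Ideal R) (e e' : ℕ) (x : R) (hx : x ∈ bracketPow I (p ^ e)) :
    x ^ p ^ e' ∈ bracketPow (bracketPow I (p ^ e')) (p ^ e) := by
  have : Fact p.Prime := ⟨hp⟩
  induction hx using Submodule.span_induction with
  | mem x h =>
    obtain ⟨i, hi, rfl⟩ := h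
    refine Ideal.subset_span ⟨i ^ p ^ e', Ideal.subset_span ⟨i, hi, rfl⟩, ?_⟩
    simp only [← pow_mul, mul_comm]
  | zero => rw [zero_pow (pow_pos hp.pos _).ne']; exact Ideal.zero_mem _
  | add x y _ _ hx hy => rw [add_pow_char_pow]; exact Ideal.add_mem _ hx hy
  | smul a x _ hx => rw [smul_eq_mul, mul_pow]; exact Ideal.mul_mem_left _ _ hx

/-- For a principal ideal `(g)`, `τ((g)^{r/p^e}) = I_e((g^r))`. -/
theorem stmt16 {R : Type*} [CommRing R] [IsNoetherianRing R] [IsLocalRing R]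
    (p : ℕ) (hp : p.Prime) [CharP R p]
    (hreg : IsRegularStmt R) (hstar : CondStar R p) (g : R)
    (r e : ℕ) (hr : 1 ≤ r) (he : 1 ≤ e) :
    tau p (Ideal.span {g}) ((r : ℝ) / (p : ℝ) ^ e) = Ie p (Ideal.span {g ^ r}) e := by
  obtain ⟨s, hs, hc⟩ := hreg
  have hdom : IsDomain R := regular_isDomain_aux s.card R s hs le_rfl (le_of_eq hc)
  have hp0 : (0 : ℝ) < p := by exact_mod_cast hp.pos
  apply le_antisymm
  · apply iSup_le
    rintro ⟨e', he'⟩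
    apply sInf_le
    simp only [Set.mem_setOf_eq]
    rw [Ideal.span_singleton_pow, Ideal.span_singleton_le_iff_mem]
    set m := ⌈(r : ℝ) / (p : ℝ) ^ e * (p : ℝ) ^ e'⌉₊ with hm
    have hle : r * p ^ e' ≤ m * p ^ e := by
      have h1 : (r : ℝ) / (p : ℝ) ^ e * (p : ℝ) ^ e' ≤ m := Nat.le_ceil _
      rw [div_mul_eq_mul_div, div_le_iff₀ (pow_pos hp0 e)] at h1
      exact_mod_cast h1
    apply mem_of_pow_mem_bracket p hp hstar e he
    have h2 := pow_mem_bracket_bracket p hp _ e e' (g ^ r)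
      (hstar (Ideal.span {g ^ r}) e he (Ideal.mem_span_singleton_self _))
    rw [← pow_mul] at h2 ⊢
    exact Ideal.mem_of_dvd _ (pow_dvd_pow g hle) h2
  · refine le_trans (le_of_eq ?_) (le_iSup (fun e' : {e : ℕ // 1 ≤ e} =>
      Ie p (Ideal.span {g} ^ ⌈(r : ℝ) / (p : ℝ) ^ e * (p : ℝ) ^ (e' : ℕ)⌉₊) (e' : ℕ)) ⟨e, he⟩)
    simp only
    rw [div_mul_cancel₀ _ (pow_pos hp0 e).ne', Nat.ceil_natCast, Ideal.span_singleton_pow]
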